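/- arXiv:1105.4130 — 11 statements merged into one kernel-verified Lean document; each statement's English description precedes it below -/
import Mathlib

section
/- Let a, b, c be three affinely independent points in the Euclidean plane such that each of the three angles of the triangle abc (namely ∠bac, ∠abc, ∠acb) is at most π/2. Then every closed ball that contains all of a, b, c has radius at least the circumradius of the triangle abc. Consequently, the circumscribed circle of an acute (or right) triangle is its minimum enclosing circle. -/
open EuclideanGeometry Real

/-- The circumcenter has barycentric coordinates proportional to
`‖b - c‖² ⟪b - a, c - a⟫` and its cyclic analogues. -/
theorem sum_smul_sub_eq_zero_of_dist_eq {a b c q : EuclideanSpace ℝ (Fin 2)}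
    (hab : dist a q = dist b q) (hac : dist a q = dist c q) :
    (dist b c ^ 2 * inner ℝ (b - a) (c - a)) • (a - q) +
      (dist a c ^ 2 * inner ℝ (a - b) (c - b)) • (b - q) +
      (dist a b ^ 2 * inner ℝ (a - c) (b - c)) • (c - q) = 0 := by
  have h₁ := congrArg (· ^ 2) hab
  have h₂ := congrArg (· ^ 2) hac
  simp only [EuclideanSpace.dist_sq_eq, Fin.sum_univ_two, Real.dist_eq, sq_abs] at h₁ h₂
  ext i
  simp only [EuclideanSpace.dist_sq_eq, Fin.sum_univ_two, Real.dist_eq, sq_abs,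
    PiLp.inner_apply, RCLike.inner_apply, conj_trivial, PiLp.add_apply, PiLp.smul_apply,
    PiLp.sub_apply, PiLp.zero_apply, smul_eq_mul]
  fin_cases i
  · simp only [Fin.zero_eta]
    linear_combination ((b 0 - a 0) * (c 1 - a 1) - (b 1 - a 1) * (c 0 - a 0)) *
      ((b 1 - a 1) * h₂ - (c 1 - a 1) * h₁)
  · simp only [Fin.mk_one]
    linear_combination ((b 0 - a 0) * (c 1 - a 1) - (b 1 - a 1) * (c 0 - a 0)) *
      ((c 0 - a 0) * h₁ - (b 0 - a 0) * h₂)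

theorem dist_le_of_inner_nonpos {V : Type*} [NormedAddCommGroup V] [InnerProductSpace ℝ V]
    {p q o : V} (h : inner ℝ (p - q) (o - q) ≤ 0) : dist p q ≤ dist p o := by
  rw [dist_eq_norm, dist_eq_norm, ← sub_sub_sub_cancel_right p o q]
  refine le_of_sq_le_sq ?_ (norm_nonneg _)
  rw [norm_sub_sq_real (p - q)]
  nlinarith [sq_nonneg ‖o - q‖]

theorem inner_sub_sub_nonneg_of_angle_le {V : Type*} [NormedAddCommGroup V]
    [InnerProductSpace ℝ V] {x y z : V} (h : angle x y z ≤ π / 2) :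
    0 ≤ inner ℝ (x - y) (z - y) := by
  rw [← InnerProductGeometry.cos_angle_mul_norm_mul_norm]
  have hcos : 0 ≤ cos (angle x y z) :=
    cos_nonneg_of_neg_pi_div_two_le_of_le (by linarith [angle_nonneg x y z, pi_pos]) h
  exact mul_nonneg hcos (by positivity)

theorem stmt1 (a b c : EuclideanSpace ℝ (Fin 2))
    (hindep : AffineIndependent ℝ ![a, b, c])
    (ha : EuclideanGeometry.angle b a c ≤ π / 2)
    (hb : EuclideanGeometry.angle a b c ≤ π / 2)
    (hc : EuclideanGeometry.angle a c b ≤ π / 2)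
    (o : EuclideanSpace ℝ (Fin 2)) (r : ℝ)
    (hao : a ∈ Metric.closedBall o r)
    (hbo : b ∈ Metric.closedBall o r)
    (hco : c ∈ Metric.closedBall o r) :
    (⟨![a, b, c], hindep⟩ : Affine.Simplex ℝ (EuclideanSpace ℝ (Fin 2)) 2).circumradius ≤ r := by
  set s : Affine.Simplex ℝ (EuclideanSpace ℝ (Fin 2)) 2 := ⟨![a, b, c], hindep⟩
  set q := s.circumcenter
  have hqa : dist a q = s.circumradius := s.dist_circumcenter_eq_circumradius 0
  have hqb : dist b q = s.circumradius := s.dist_circumcenter_eq_circumradius 1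
  have hqc : dist c q = s.circumradius := s.dist_circumcenter_eq_circumradius 2
  have hab : 0 < dist a b :=
    dist_pos.2 fun h ↦ by simpa using hindep.injective (show ![a, b, c] 0 = ![a, b, c] 1 from h)
  have hac : 0 < dist a c :=
    dist_pos.2 fun h ↦ by simpa using hindep.injective (show ![a, b, c] 0 = ![a, b, c] 2 from h)
  have hbc : 0 < dist b c :=
    dist_pos.2 fun h ↦ by simpa using hindep.injective (show ![a, b, c] 1 = ![a, b, c] 2 from h)
  rw [Metric.mem_closedBall] at hao hbo hco
  by_contra! hr
  have ia : 0 < inner ℝ (a - q) (o - q) := by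
    by_contra! h
    linarith only [dist_le_of_inner_nonpos h, hr, hqa, hqb, hqc, hao, hbo, hco]
  have ib : 0 < inner ℝ (b - q) (o - q) := by
    by_contra! h
    linarith only [dist_le_of_inner_nonpos h, hr, hqa, hqb, hqc, hao, hbo, hco]
  have ic : 0 < inner ℝ (c - q) (o - q) := by
    by_contra! h
    linarith only [dist_le_of_inner_nonpos h, hr, hqa, hqb, hqc, hao, hbo, hco]
  have na := inner_sub_sub_nonneg_of_angle_le ha
  have nb := inner_sub_sub_nonneg_of_angle_le hb
  have nc := inner_sub_sub_nonneg_of_angle_le hc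
  have key := congrArg (inner ℝ · (o - q))
    (sum_smul_sub_eq_zero_of_dist_eq (hqa.trans hqb.symm) (hqa.trans hqc.symm))
  simp only [inner_add_left, real_inner_smul_left, inner_zero_left] at key
  have hsum : inner ℝ (b - a) (c - a) + inner ℝ (a - b) (c - b) = dist a b ^ 2 := by
    rw [dist_eq_norm, ← real_inner_self_eq_norm_sq, ← neg_sub a b, inner_neg_left,
      neg_add_eq_sub, ← inner_sub_right, sub_sub_sub_cancel_left]
  have hpos : 0 < inner ℝ (b - a) (c - a) ∨ 0 < inner ℝ (a - b) (c - b) := by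
    by_contra! h
    linarith [pow_pos hab 2]
  rcases hpos with h | h
  · have : 0 < dist b c ^ 2 * inner ℝ (b - a) (c - a) * inner ℝ (a - q) (o - q) := by positivity
    have : 0 ≤ dist a c ^ 2 * inner ℝ (a - b) (c - b) * inner ℝ (b - q) (o - q) := by positivity
    have : 0 ≤ dist a b ^ 2 * inner ℝ (a - c) (b - c) * inner ℝ (c - q) (o - q) := by positivity
    linarith
  · have : 0 ≤ dist b c ^ 2 * inner ℝ (b - a) (c - a) * inner ℝ (a - q) (o - q) := by positivity
    have : 0 < dist a c ^ 2 * inner ℝ (a - b) (c - b) * inner ℝ (b - q) (o - q) := by positivity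
    have : 0 ≤ dist a b ^ 2 * inner ℝ (a - c) (b - c) * inner ℝ (c - q) (o - q) := by positivity
    linarith
end

section
/- Let S be a finite set of points in the Euclidean plane, let v be a point of the plane, and let p, q ∈ S be distinct. For a set T of points, let ρ(T) denote the infimum of all real r ≥ 0 such that T is contained in some closed ball of radius r. Suppose that for all a, b ∈ S with a ≠ b and {a,b} ≠ {p,q} one has ρ({v,p,q}) < ρ({v,a,b}). Then for every point o and every real r with r ≤ ρ({v,p,q}) such that the closed ball of center o and radius r contains v, p, and q, no point of S \ {p,q} lies in that closed ball. (In particular, p and q span an edge of the Delaunay triangulation of S.) -/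
/-- `rho T` is the radius of the minimum enclosing circle of `T`: the infimum of all
radii `r ≥ 0` such that `T` is contained in some closed ball of radius `r`. -/
noncomputable def rho (T : Set (EuclideanSpace ℝ (Fin 2))) : ℝ :=
  sInf {r : ℝ | 0 ≤ r ∧ ∃ o : EuclideanSpace ℝ (Fin 2), T ⊆ Metric.closedBall o r}

/-- The minimum enclosing radius of `T` is at most the radius of any closed ball containing `T`. -/
theorem rho_le_of_subset_closedBall {T : Set (EuclideanSpace ℝ (Fin 2))}
    {o : EuclideanSpace ℝ (Fin 2)} {r : ℝ} (hr : 0 ≤ r) (hT : T ⊆ Metric.closedBall o r) :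
    rho T ≤ r :=
  csInf_le ⟨0, fun _ h => h.1⟩ ⟨hr, o, hT⟩

theorem stmt3 (S : Finset (EuclideanSpace ℝ (Fin 2))) (v p q : EuclideanSpace ℝ (Fin 2))
    (hp : p ∈ S) (hq : q ∈ S) (hpq : p ≠ q)
    (hmin : ∀ a ∈ S, ∀ b ∈ S, a ≠ b → ({a, b} : Set (EuclideanSpace ℝ (Fin 2))) ≠ {p, q} →
      rho {v, p, q} < rho {v, a, b})
    (o : EuclideanSpace ℝ (Fin 2)) (r : ℝ) (hr : r ≤ rho {v, p, q})
    (hvo : v ∈ Metric.closedBall o r) (hpo : p ∈ Metric.closedBall o r)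
    (hqo : q ∈ Metric.closedBall o r) :
    ∀ s ∈ S, s ≠ p → s ≠ q → s ∉ Metric.closedBall o r := by
  intro s hs hsp hsq hso
  have hne : ({p, s} : Set (EuclideanSpace ℝ (Fin 2))) ≠ {p, q} := by
    intro h
    have hmem : s ∈ ({p, q} : Set (EuclideanSpace ℝ (Fin 2))) := h ▸ Or.inr rfl
    exact hmem.elim hsp hsq
  have hsub : ({v, p, s} : Set (EuclideanSpace ℝ (Fin 2))) ⊆ Metric.closedBall o r := by
    rintro x (rfl | rfl | rfl) <;> assumption
  have hr0 : 0 ≤ r := dist_nonneg.trans (Metric.mem_closedBall.mp hvo)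
  exact (hmin p hp s hs hsp.symm hne).not_ge ((rho_le_of_subset_closedBall hr0 hsub).trans hr)
end

section
/- Let S be a finite set of points in the Euclidean plane and let p, q ∈ S be distinct such that for every s ∈ S \ {p,q}, dist(p,q) < dist(p,s) (i.e., q is the unique nearest neighbor of p in S). For a set T of points, let ρ(T) denote the infimum of all real r ≥ 0 such that T is contained in some closed ball of radius r. Then there exists ε > 0 such that for every point v lying strictly between p and q with dist(p,v) < ε, and for all a, b ∈ S with a ≠ b and {a,b} ≠ {p,q}, one has ρ({v,p,q}) < ρ({v,a,b}). -/
theorem half_dist_le_rho {T : Set (EuclideanSpace ℝ (Fin 2))} (hT : Bornology.IsBounded T)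
    {x y : EuclideanSpace ℝ (Fin 2)} (hx : x ∈ T) (hy : y ∈ T) : dist x y / 2 ≤ rho T := by
  refine le_csInf ?_ ?_
  · obtain ⟨r, hr, h⟩ := hT.subset_closedBall_lt 0 0
    exact ⟨r, hr.le, 0, h⟩
  · rintro r ⟨-, o, ho⟩
    have hxo : dist x o ≤ r := ho hx
    have hyo : dist y o ≤ r := ho hy
    linarith [dist_triangle_right x y o]

theorem rho_le_half_dist_of_wbtw {p v q : EuclideanSpace ℝ (Fin 2)} (hv : Wbtw ℝ p v q) :
    rho {v, p, q} ≤ dist p q / 2 := by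
  have hp : p ∈ Metric.closedBall (midpoint ℝ p q) (dist p q / 2) := by
    rw [Metric.mem_closedBall, dist_left_midpoint, Real.norm_two]
    linarith
  have hq : q ∈ Metric.closedBall (midpoint ℝ p q) (dist p q / 2) := by
    rw [Metric.mem_closedBall, dist_right_midpoint, Real.norm_two]
    linarith
  refine rho_le_of_subset_closedBall (by positivity) (o := midpoint ℝ p q) ?_
  rintro x (rfl | rfl | rfl)
  · exact (convex_closedBall _ _).segment_subset hp hq (mem_segment_iff_wbtw.2 hv)
  · exact hp
  · exact hq

theorem stmt4 (S : Finset (EuclideanSpace ℝ (Fin 2))) (p q : EuclideanSpace ℝ (Fin 2))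
    (hp : p ∈ S) (hq : q ∈ S) (hpq : p ≠ q)
    (hnear : ∀ s ∈ S, s ≠ p → s ≠ q → dist p q < dist p s) :
    ∃ ε > (0 : ℝ), ∀ v : EuclideanSpace ℝ (Fin 2), Sbtw ℝ p v q → dist p v < ε →
      ∀ a ∈ S, ∀ b ∈ S, a ≠ b → ({a, b} : Set (EuclideanSpace ℝ (Fin 2))) ≠ {p, q} →
        rho {v, p, q} < rho {v, a, b} := by
  have hsep : ∃ ε > (0 : ℝ), ∀ s ∈ S, s ≠ p → s ≠ q → dist p q + ε < dist p s := by
    have h : ∀ᶠ ε in nhdsWithin (0 : ℝ) (Set.Ioi 0),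
        ∀ s ∈ S, s ≠ p → s ≠ q → dist p q + ε < dist p s := by
      rw [Filter.eventually_all_finset]
      intro s hs
      by_cases hsp : s = p
      · simp [hsp]
      by_cases hsq : s = q
      · simp [hsq]
      filter_upwards [Ioo_mem_nhdsGT (sub_pos.2 (hnear s hs hsp hsq))] with ε hε _ _
      linarith [hε.2]
    obtain ⟨ε, hε, hpos⟩ := (h.and self_mem_nhdsWithin).exists
    exact ⟨ε, hpos, hε⟩
  obtain ⟨ε, hpos, hε⟩ := hsep
  refine ⟨ε, hpos, fun v hv hvε a ha b hb hab hne => ?_⟩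
  have hs : ∃ s ∈ S, s ∈ ({v, a, b} : Set (EuclideanSpace ℝ (Fin 2))) ∧ s ≠ p ∧ s ≠ q := by
    by_cases h : a ≠ p ∧ a ≠ q
    · exact ⟨a, ha, by simp, h⟩
    refine ⟨b, hb, by simp, ?_, ?_⟩ <;> rintro rfl
    · obtain rfl : a = q := by tauto
      exact hne (Set.pair_comm _ _)
    · obtain rfl : a = p := by tauto
      exact hne rfl
  obtain ⟨s, hsS, hsT, hsp, hsq⟩ := hs
  have hlow := half_dist_le_rho (Set.toFinite {v, a, b}).isBounded (Set.mem_insert v _) hsT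
  linarith [rho_le_half_dist_of_wbtw hv.wbtw, hε s hsS hsp hsq, dist_triangle p v s]
end

section
/- Let S be a finite set of points in the Euclidean plane, let p, q ∈ S be distinct, and let v be a point not collinear with p and q such that dist(v,p) ≤ dist(v,q). Suppose that for all a, b ∈ S with a ≠ b, dist(v,p) + dist(v,q) + dist(p,q) ≤ dist(v,a) + dist(v,b) + dist(a,b). Then there exists a point o on the closed segment from v to p such that dist(o,p) ≤ dist(o,q) and, for every s ∈ S with s ≠ p and s ≠ q, dist(o,s) ≥ dist(o,q). (That is, the closed ball centered at o with q on its boundary contains p, and no other site of S lies in its interior; hence p and q span a Delaunay edge of S.) -/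
/-- Stewart's theorem for the point dividing the segment from `v` to `p` in the ratio `b : a`. -/
theorem dist_sq_smul_add_smul {E : Type*} [NormedAddCommGroup E] [InnerProductSpace ℝ E]
    (v p s : E) {a b : ℝ} (hab : a + b = 1) :
    dist (a • v + b • p) s ^ 2 =
      a * dist v s ^ 2 + b * dist p s ^ 2 - a * b * dist v p ^ 2 := by
  obtain rfl : a = 1 - b := by linarith
  have h₁ : (1 - b) • v + b • p - s = (1 - b) • (v - s) + b • (p - s) := by module
  have h₂ : ‖v - p‖ ^ 2 = ‖v - s‖ ^ 2 - 2 * inner ℝ (v - s) (p - s) + ‖p - s‖ ^ 2 := by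
    rw [← norm_sub_sq_real, sub_sub_sub_cancel_right]
  rw [dist_eq_norm, dist_eq_norm, dist_eq_norm, dist_eq_norm, h₁, h₂, norm_add_sq_real,
    norm_smul, norm_smul, inner_smul_left, inner_smul_right, mul_pow, mul_pow,
    Real.norm_eq_abs, Real.norm_eq_abs, sq_abs, sq_abs]
  simp only [conj_trivial]
  ring

/-- A weighted sum of squares is minimal, for a given lower bound on `x + y`, at `(m, n)`. -/
theorem mul_sq_add_mul_sq_le {m n x y : ℝ} (hm : 0 ≤ m) (hn : 0 ≤ n) (hmn : 0 < m + n)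
    (h : m + n ≤ x + y) : n * m ^ 2 + m * n ^ 2 ≤ n * x ^ 2 + m * y ^ 2 := by
  have hsq : (m + n) ^ 2 ≤ (x + y) ^ 2 := pow_le_pow_left₀ hmn.le h 2
  refine le_of_mul_le_mul_left ?_ hmn
  nlinarith [sq_nonneg (n * x - m * y), mul_le_mul_of_nonneg_left hsq (mul_nonneg hm hn)]


theorem stmt5 (S : Finset (EuclideanSpace ℝ (Fin 2))) (p q : EuclideanSpace ℝ (Fin 2))
    (hp : p ∈ S) (hq : q ∈ S) (hpq : p ≠ q) (v : EuclideanSpace ℝ (Fin 2))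
    (hncol : ¬ Collinear ℝ ({v, p, q} : Set (EuclideanSpace ℝ (Fin 2))))
    (hvpq : dist v p ≤ dist v q)
    (hmin : ∀ a ∈ S, ∀ b ∈ S, a ≠ b →
      dist v p + dist v q + dist p q ≤ dist v a + dist v b + dist a b) :
    ∃ o ∈ segment ℝ v p, dist o p ≤ dist o q ∧
      ∀ s ∈ S, s ≠ p → s ≠ q → dist o q ≤ dist o s := by
  -- `o` is the foot on `vp` of the bisector of the angle at `q`.
  set m := dist v q with hm
  set n := dist p q with hn
  have hm0 : 0 ≤ m := dist_nonneg
  have hn0 : 0 < n := dist_pos.2 hpq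
  have hmn : 0 < m + n := by linarith
  have hab : n / (m + n) + m / (m + n) = 1 := by field_simp; ring
  refine ⟨(n / (m + n)) • v + (m / (m + n)) • p,
    ⟨n / (m + n), m / (m + n), by positivity, by positivity, hab, rfl⟩, ?_, ?_⟩
  · refine (sq_le_sq₀ dist_nonneg dist_nonneg).1 ?_
    rw [dist_sq_smul_add_smul v p p hab, dist_sq_smul_add_smul v p q hab, dist_self, ← hm, ← hn]
    have hd : dist v p ^ 2 ≤ m * (m + n) := by
      nlinarith [pow_le_pow_left₀ dist_nonneg hvpq 2, mul_nonneg hm0 hn0.le]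
    have key : n / (m + n) * dist v p ^ 2 ≤ n / (m + n) * m ^ 2 + m / (m + n) * n ^ 2 := by
      calc n / (m + n) * dist v p ^ 2 ≤ n / (m + n) * (m * (m + n)) := by gcongr
        _ = n / (m + n) * m ^ 2 + m / (m + n) * n ^ 2 := by field_simp
    linarith
  · intro s hs hsp _
    have hsum : m + n ≤ dist v s + dist p s := by linarith [hmin p hp s hs hsp.symm]
    refine (sq_le_sq₀ dist_nonneg dist_nonneg).1 ?_
    rw [dist_sq_smul_add_smul v p q hab, dist_sq_smul_add_smul v p s hab, ← hm, ← hn]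
    have key := div_le_div_of_nonneg_right (mul_sq_add_mul_sq_le hm0 hn0.le hmn hsum) hmn.le
    rw [add_div, add_div, mul_div_right_comm, mul_div_right_comm, mul_div_right_comm,
      mul_div_right_comm] at key
    linarith
end

section
/- Let v, p, q be three noncollinear points in the Euclidean plane with dist(v,p) ≤ dist(v,q), and let E = {x : dist(v,x) + dist(p,x) ≤ dist(v,q) + dist(p,q)} be the closed elliptical region with foci v and p passing through q. Then there exists a point o on the closed segment from v to p such that dist(o,p) ≤ dist(o,q) and the closed ball centered at o with radius dist(o,q) is contained in E. (This closed ball has q on its boundary and contains p.) -/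
/-- **Stewart's theorem** in an inner product space, for a point `t • v + s • p` of the line
through `v` and `p`. -/
theorem dist_sq_affineCombination {V : Type*} [NormedAddCommGroup V] [InnerProductSpace ℝ V]
    (x v p : V) {t s : ℝ} (hts : t + s = 1) :
    dist (t • v + s • p) x ^ 2 = t * dist v x ^ 2 + s * dist p x ^ 2 - t * s * dist v p ^ 2 := by
  have h₁ : t • v + s • p - x = t • (v - x) + s • (p - x) := by
    rw [smul_sub, smul_sub, sub_add_sub_comm, ← add_smul, hts, one_smul]
  have h₂ : v - p = (v - x) - (p - x) := by abel
  rw [dist_eq_norm, dist_eq_norm, dist_eq_norm, dist_eq_norm, h₁, h₂, norm_add_sq_real,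
    norm_sub_sq_real (v - x), norm_smul, norm_smul, mul_pow, mul_pow, Real.norm_eq_abs, Real.norm_eq_abs,
    sq_abs, sq_abs, real_inner_smul_left, real_inner_smul_right]
  obtain rfl : s = 1 - t := by linarith
  ring

/-- The Cauchy–Schwarz inequality with weights `b` and `a`. -/
theorem add_le_add_of_weighted_sq_le {a b x y : ℝ} (ha : 0 < a) (hb : 0 < b)
    (h : b * x ^ 2 + a * y ^ 2 ≤ a * b * (a + b)) : x + y ≤ a + b := by
  refine le_of_sq_le_sq ?_ (by positivity)
  refine le_of_mul_le_mul_left ?_ (mul_pos ha hb)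
  calc a * b * (x + y) ^ 2 ≤ (a + b) * (b * x ^ 2 + a * y ^ 2) := by
        linarith [sq_nonneg (b * x - a * y)]
    _ ≤ (a + b) * (a * b * (a + b)) := by gcongr
    _ = a * b * (a + b) ^ 2 := by ring

/-- The centre `o` is the foot on `v p` of the bisector of the angle at `q`. -/
theorem stmt6 (v p q : EuclideanSpace ℝ (Fin 2))
    (hncol : ¬ Collinear ℝ ({v, p, q} : Set (EuclideanSpace ℝ (Fin 2))))
    (hvpq : dist v p ≤ dist v q) :
    ∃ o ∈ segment ℝ v p, dist o p ≤ dist o q ∧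
      Metric.closedBall o (dist o q) ⊆
        {x : EuclideanSpace ℝ (Fin 2) | dist v x + dist p x ≤ dist v q + dist p q} := by
  have ha : 0 < dist v q := dist_pos.mpr (ne₁₃_of_not_collinear hncol)
  have hb : 0 < dist p q := dist_pos.mpr (ne₂₃_of_not_collinear hncol)
  have hc : 0 ≤ dist v p := dist_nonneg
  set a := dist v q with ha_def
  set b := dist p q with hb_def
  set c := dist v p
  have hab : 0 < a + b := add_pos ha hb
  have hts : b / (a + b) + a / (a + b) = 1 := by field_simp; ring
  have stewart := fun x ↦ dist_sq_affineCombination x v p hts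
  refine ⟨(b / (a + b)) • v + (a / (a + b)) • p,
    ⟨b / (a + b), a / (a + b), by positivity, by positivity, hts, rfl⟩, ?_, fun x hx ↦ ?_⟩
  · refine le_of_sq_le_sq ?_ dist_nonneg
    rw [stewart, stewart, dist_self, ← ha_def, ← hb_def]
    have hca : c ^ 2 ≤ a * (a + b) := by nlinarith
    have key : b / (a + b) * c ^ 2 ≤ b / (a + b) * (a * (a + b)) := by gcongr
    have hsum : b / (a + b) * a ^ 2 + a / (a + b) * b ^ 2 = b / (a + b) * (a * (a + b)) := by
      field_simp
    linarith
  · have hx' := pow_le_pow_left₀ dist_nonneg (Metric.mem_closedBall'.mp hx) 2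
    rw [stewart, stewart, ← ha_def, ← hb_def, sub_le_sub_iff_right] at hx'
    refine add_le_add_of_weighted_sq_le ha hb ?_
    field_simp at hx'
    linarith
end

section
/- Let c ≥ 0 be a real number, let v, p, q be three noncollinear points in the Euclidean plane with dist(v,p) ≤ dist(v,q), and let E_c = {x : dist(v,x) + c·dist(p,x) ≤ dist(v,q) + c·dist(p,q)} be the closed region bounded by the Cartesian oval with foci v and p passing through q. Then there exists a point o on the closed segment from v to p such that dist(o,p) ≤ dist(o,q) and the closed ball centered at o with radius dist(o,q) is contained in E_c. (This closed ball has q on its boundary and contains p.) -/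
/-- Stewart's theorem, with the foot given as an affine combination. -/
theorem dist_sq_affine_combination {E : Type*} [NormedAddCommGroup E] [InnerProductSpace ℝ E]
    (v p x : E) (t : ℝ) :
    (1 - t) * dist v x ^ 2 + t * dist p x ^ 2 =
      dist x (v + t • (p - v)) ^ 2 + t * (1 - t) * dist v p ^ 2 := by
  have h₁ : p - x = (p - v) - (x - v) := by abel
  have h₂ : x - (v + t • (p - v)) = (x - v) - t • (p - v) := by abel
  rw [dist_comm v x, dist_comm v p, dist_eq_norm x v, dist_eq_norm p x, dist_eq_norm p v,
    dist_eq_norm x (v + t • (p - v)), h₁, h₂, norm_sub_sq_real (p - v), norm_sub_sq_real (x - v), norm_smul,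
    inner_smul_right, mul_pow, Real.norm_eq_abs, sq_abs, real_inner_comm (x - v) (p - v)]
  ring

theorem stmt7 (c : ℝ) (hc : 0 ≤ c) (v p q : EuclideanSpace ℝ (Fin 2))
    (hncol : ¬ Collinear ℝ ({v, p, q} : Set (EuclideanSpace ℝ (Fin 2))))
    (hvpq : dist v p ≤ dist v q) :
    ∃ o ∈ segment ℝ v p, dist o p ≤ dist o q ∧
      Metric.closedBall o (dist o q) ⊆
        {x : EuclideanSpace ℝ (Fin 2) |
          dist v x + c * dist p x ≤ dist v q + c * dist p q} := by
  have ha : 0 < dist v q := dist_pos.2 (ne₁₃_of_not_collinear hncol)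
  have hb : 0 < dist p q := dist_pos.2 (ne₂₃_of_not_collinear hncol)
  set a := dist v q with ha_def
  set b := dist p q with hb_def
  have hs : 0 < b + c * a := by positivity
  -- The normal to the oval at `q` meets the segment at `v + t • (p - v)`.
  set t := c * a / (b + c * a) with ht
  have ht0 : 0 ≤ t := by positivity
  have ht1 : t ≤ 1 := by rw [ht, div_le_one hs]; linarith
  have hts : t * (b + c * a) = c * a := div_mul_cancel₀ _ hs.ne'
  have hseg : v + t • (p - v) ∈ segment ℝ v p := by
    rw [segment_eq_image']
    exact ⟨t, ⟨ht0, ht1⟩, rfl⟩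
  refine ⟨v + t • (p - v), hseg, ?_, fun x hx => ?_⟩
  · have h₁ := dist_add_dist_of_mem_segment hseg
    have h₂ := dist_triangle v (v + t • (p - v)) q
    linarith
  · rw [Metric.mem_closedBall, dist_comm _ q] at hx
    have hx' := pow_le_pow_left₀ dist_nonneg hx 2
    have hX := dist_sq_affine_combination v p x t
    have hQ := dist_sq_affine_combination v p q t
    rw [← ha_def, ← hb_def] at hQ
    show dist v x + c * dist p x ≤ a + c * b
    generalize dist v x = X at *
    generalize dist p x = Y at *
    have h₁ : (1 - t) * X ^ 2 + t * Y ^ 2 ≤ (1 - t) * a ^ 2 + t * b ^ 2 := by linarith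
    have h₂ : b * X ^ 2 + c * a * Y ^ 2 ≤ b * a ^ 2 + c * a * b ^ 2 := by
      have h₃ := mul_le_mul_of_nonneg_left h₁ hs.le
      have h₄ : (b + c * a) * (1 - t) = b := by linarith
      have h₅ : (b + c * a) * t = c * a := by linarith
      simpa only [mul_add, ← mul_assoc, h₄, h₅] using h₃
    have h₆ : 0 ≤ b * (X - a) ^ 2 := by positivity
    have h₇ : 0 ≤ c * a * (Y - b) ^ 2 := by positivity
    refine le_of_mul_le_mul_left ?_ (mul_pos ha hb)
    linarith
end

section
/- Let c ≥ 0 be a real number, let S be a finite set of points in the Euclidean plane, let p, q ∈ S be distinct, and let v be a point not collinear with p and q such that dist(v,p) ≤ dist(v,q). Suppose that for all a, b ∈ S with a ≠ b, dist(v,p) + dist(v,q) + c·dist(p,q) ≤ dist(v,a) + dist(v,b) + c·dist(a,b). Then there exists a point o on the closed segment from v to p such that dist(o,p) ≤ dist(o,q) and, for every s ∈ S with s ≠ p and s ≠ q, dist(o,s) ≥ dist(o,q). (That is, there is a closed disk with q on its boundary containing p whose interior contains no other site of S; hence p and q span a Delaunay edge of S.) -/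
/-- Stewart's theorem, for a point dividing a segment in an inner product space. -/
theorem dist_sq_combo {E : Type*} [NormedAddCommGroup E] [InnerProductSpace ℝ E]
    {a b : ℝ} (hab : a + b = 1) (v p x : E) :
    dist (a • v + b • p) x ^ 2 =
      a * dist v x ^ 2 + b * dist p x ^ 2 - a * b * dist v p ^ 2 := by
  have hx : a • v + b • p - x = a • (v - x) + b • (p - x) := by
    obtain rfl : a = 1 - b := by linarith
    module
  have hvp : v - p = (v - x) - (p - x) := by abel
  rw [dist_eq_norm, dist_eq_norm, dist_eq_norm, dist_eq_norm, hx, hvp, norm_add_sq_real,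
    norm_sub_sq_real (v - x), norm_smul, norm_smul, inner_smul_left, inner_smul_right, mul_pow, mul_pow]
  simp only [Real.norm_eq_abs, sq_abs, conj_trivial]
  obtain rfl : a = 1 - b := by linarith
  ring

/-- A sum `r + c * s` of weighted distances is decreased when the quadratic form
tangent to it at `(A, B)` is. -/
theorem add_mul_lt_of_div_sq_lt {A B c r s : ℝ} (hA : 0 < A) (hB : 0 < B) (hc : 0 ≤ c)
    (h : r ^ 2 / A + c / B * s ^ 2 < A ^ 2 / A + c / B * B ^ 2) : r + c * s < A + c * B := by
  have hr : r ≤ (r ^ 2 / A + A) / 2 := by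
    have : (r ^ 2 / A + A) / 2 - r = (r - A) ^ 2 / A / 2 := by field_simp; ring
    have : 0 ≤ (r - A) ^ 2 / A / 2 := by positivity
    linarith
  have hs : c * s ≤ (c / B * s ^ 2 + c * B) / 2 := by
    have : (c / B * s ^ 2 + c * B) / 2 - c * s = c * (s - B) ^ 2 / B / 2 := by field_simp; ring
    have : 0 ≤ c * (s - B) ^ 2 / B / 2 := by positivity
    linarith
  have hA' : A ^ 2 / A = A := by field_simp
  have hB' : c / B * B ^ 2 = c * B := by field_simp
  linarith


theorem stmt8 (c : ℝ) (hc : 0 ≤ c) (S : Finset (EuclideanSpace ℝ (Fin 2)))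
    (p q : EuclideanSpace ℝ (Fin 2))
    (hp : p ∈ S) (hq : q ∈ S) (hpq : p ≠ q) (v : EuclideanSpace ℝ (Fin 2))
    (hncol : ¬ Collinear ℝ ({v, p, q} : Set (EuclideanSpace ℝ (Fin 2))))
    (hvpq : dist v p ≤ dist v q)
    (hmin : ∀ a ∈ S, ∀ b ∈ S, a ≠ b →
      dist v p + dist v q + c * dist p q ≤ dist v a + dist v b + c * dist a b) :
    ∃ o ∈ segment ℝ v p, dist o p ≤ dist o q ∧
      ∀ s ∈ S, s ≠ p → s ≠ q → dist o q ≤ dist o s := by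
  have hvq : v ≠ q := by
    rintro rfl
    exact hncol (by simpa [Set.pair_comm, Set.insert_comm] using collinear_pair ℝ p v)
  have hA : 0 < dist v q := dist_pos.2 hvq
  have hB : 0 < dist p q := dist_pos.2 hpq
  have hw : 0 < 1 / dist v q + c / dist p q := by positivity
  obtain ⟨w, hwdef⟩ : ∃ w, w = 1 / dist v q + c / dist p q := ⟨_, rfl⟩
  rw [← hwdef] at hw
  obtain ⟨a, ha⟩ : ∃ a, a = 1 / dist v q / w := ⟨_, rfl⟩
  obtain ⟨b, hb⟩ : ∃ b, b = c / dist p q / w := ⟨_, rfl⟩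
  have ha0 : 0 ≤ a := by rw [ha]; positivity
  have hb0 : 0 ≤ b := by rw [hb]; positivity
  have hab : a + b = 1 := by rw [ha, hb, ← add_div, ← hwdef, div_self hw.ne']
  have hwa : w * a = 1 / dist v q := by rw [ha]; field_simp
  have hwb : w * b = c / dist p q := by rw [hb]; field_simp
  refine ⟨a • v + b • p, ⟨a, b, ha0, hb0, hab, rfl⟩, ?_, ?_⟩
  · refine (sq_le_sq₀ dist_nonneg dist_nonneg).1 ?_
    rw [dist_sq_combo hab, dist_sq_combo hab, dist_self]
    have h₁ : a * dist v p ^ 2 ≤ a * dist v q ^ 2 := by gcongr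
    have h₂ : 0 ≤ b * dist p q ^ 2 := by positivity
    linarith
  · intro s hs hsp _
    by_contra! hlt
    have hsq : dist (a • v + b • p) s ^ 2 < dist (a • v + b • p) q ^ 2 := by gcongr
    rw [dist_sq_combo hab, dist_sq_combo hab] at hsq
    have hlt' : w * (a * dist v s ^ 2 + b * dist p s ^ 2) <
        w * (a * dist v q ^ 2 + b * dist p q ^ 2) :=
      mul_lt_mul_of_pos_left (by linarith) hw
    simp only [mul_add, ← mul_assoc, hwa, hwb, one_div_mul_eq_div] at hlt'
    have := add_mul_lt_of_div_sq_lt hA hB hc hlt'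
    linarith [hmin p hp s hs hsp.symm]
end

section
/- Let S be a finite set of points in the Euclidean plane and let p, q ∈ S be distinct such that dist(p,q) < dist(a,b) for all a, b ∈ S with a ≠ b and {a,b} ≠ {p,q} (i.e., (p,q) is the unique closest pair in S). Then there exists a real c₀ ≥ 0 such that for every real c ≥ c₀, every point v of the plane, and all a, b ∈ S with a ≠ b and {a,b} ≠ {p,q}, one has dist(v,p) + dist(v,q) + c·dist(p,q) < dist(v,a) + dist(v,b) + c·dist(a,b). (Hence, as c → ∞, the nearest-neighbor 2-site Voronoi diagram under 𝒫_c consists of the single region of the pair (p,q) covering the whole plane.) -/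
theorem stmt9 (S : Finset (EuclideanSpace ℝ (Fin 2))) (p q : EuclideanSpace ℝ (Fin 2))
    (hp : p ∈ S) (hq : q ∈ S) (hpq : p ≠ q)
    (hclosest : ∀ a ∈ S, ∀ b ∈ S, a ≠ b →
      ({a, b} : Set (EuclideanSpace ℝ (Fin 2))) ≠ {p, q} → dist p q < dist a b) :
    ∃ c₀ : ℝ, 0 ≤ c₀ ∧ ∀ c : ℝ, c₀ ≤ c → ∀ v : EuclideanSpace ℝ (Fin 2),
      ∀ a ∈ S, ∀ b ∈ S, a ≠ b → ({a, b} : Set (EuclideanSpace ℝ (Fin 2))) ≠ {p, q} →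
        dist v p + dist v q + c * dist p q < dist v a + dist v b + c * dist a b := by
  classical
  obtain ⟨M, hM⟩ := ((S ×ˢ S).image fun x =>
    (dist x.1 p + dist x.2 q) / (dist x.1 x.2 - dist p q)).exists_le
  refine ⟨max 0 M + 1, by positivity, fun c hc v a ha b hb hab hne => ?_⟩
  have hgap : 0 < dist a b - dist p q := sub_pos.2 (hclosest a ha b hb hab hne)
  have hratio : (dist a p + dist b q) / (dist a b - dist p q) < c := by
    have := hM _ (Finset.mem_image_of_mem _ (Finset.mk_mem_product ha hb))
    linarith [le_max_right 0 M]
  rw [div_lt_iff₀ hgap] at hratio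
  linarith [dist_triangle v a p, dist_triangle v b q]
end

section
/- Let v, p, q be three affinely independent points in the Euclidean plane and let o be the circumcenter of the triangle vpq. Then dist(o,p) + dist(o,q) + dist(p,q) ≥ 2·dist(p,q), and equality holds if and only if dist(v, midpoint(p,q)) = dist(p,q)/2, i.e., if and only if v lies on the circle with diameter pq. -/
theorem stmt10 (v p q : EuclideanSpace ℝ (Fin 2))
    (hindep : AffineIndependent ℝ ![v, p, q])
    (o : EuclideanSpace ℝ (Fin 2))
    (ho : o = (⟨![v, p, q], hindep⟩ :
      Affine.Simplex ℝ (EuclideanSpace ℝ (Fin 2)) 2).circumcenter) :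
    2 * dist p q ≤ dist o p + dist o q + dist p q ∧
      (dist o p + dist o q + dist p q = 2 * dist p q ↔
        dist v (midpoint ℝ p q) = dist p q / 2) := by
  let T : Affine.Simplex ℝ (EuclideanSpace ℝ (Fin 2)) 2 := ⟨![v, p, q], hindep⟩
  have hv : dist o v = T.circumradius := by
    rw [ho]; exact T.dist_circumcenter_eq_circumradius' 0
  have hp : dist o p = T.circumradius := by
    rw [ho]; exact T.dist_circumcenter_eq_circumradius' 1
  have hq : dist o q = T.circumradius := by
    rw [ho]; exact T.dist_circumcenter_eq_circumradius' 2
  have htri : dist p q ≤ dist o p + dist o q := dist_triangle_left p q o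
  refine ⟨by linarith, fun h => ?_, fun h => ?_⟩
  · have hmid : o = midpoint ℝ p q :=
      eq_midpoint_of_dist_eq_half (by rw [dist_comm]; linarith) (by linarith)
    rw [← hmid, dist_comm]
    linarith
  · have hmem : midpoint ℝ p q ∈ affineSpan ℝ (Set.range T.points) :=
      AffineMap.lineMap_mem _ (mem_affineSpan ℝ ⟨1, rfl⟩) (mem_affineSpan ℝ ⟨2, rfl⟩)
    have hmid : midpoint ℝ p q = o := by
      rw [ho]
      refine T.eq_circumcenter_of_dist_eq hmem (r := dist p q / 2) fun i => ?_
      fin_cases i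
      · exact h
      · change dist p (midpoint ℝ p q) = _
        rw [dist_left_midpoint, Real.norm_ofNat]
        ring
      · change dist q (midpoint ℝ p q) = _
        rw [dist_right_midpoint, Real.norm_ofNat]
        ring
    rw [hmid, dist_comm] at h
    linarith
end

section
/- Let s and t be distinct points of the Euclidean plane, let a be a point, and let u be a unit vector in ℝ² that is not parallel to t − s. For x ∈ ℝ let v(x) = a + x·u, and define the inradius of the triangle v(x)st as r(x) = |det(s − v(x), t − v(x))| / (dist(v(x),s) + dist(v(x),t) + dist(s,t)), where det((w₁,w₂),(z₁,z₂)) = w₁z₂ − w₂z₁ (so that |det(s − v, t − v)|/2 is the area of the triangle vst and r = 2·Area/Perimeter). Then r(x) tends, as x → +∞, to half the distance from t to the line through s with direction u, i.e., lim_{x→∞} r(x) = |det(u, t − s)| / 2. -/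
/-- The 2×2 determinant of two planar vectors. -/
def det2 (w z : EuclideanSpace ℝ (Fin 2)) : ℝ := w 0 * z 1 - w 1 * z 0

open Filter Topology in
/-- The distance from a fixed point to a point moving along a ray grows at the speed of the ray. -/
theorem tendsto_dist_add_smul_div_atTop {E : Type*} [NormedAddCommGroup E] [NormedSpace ℝ E]
    (a u p : E) :
    Tendsto (fun x : ℝ => dist (a + x • u) p / x) atTop (𝓝 ‖u‖) := by
  have h : Tendsto (fun x : ℝ => ‖x⁻¹ • (a - p) + u‖) atTop (𝓝 ‖u‖) := by
    simpa using (((tendsto_inv_atTop_zero (𝕜 := ℝ)).smul_const (a - p)).add_const u).norm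
  refine h.congr' ?_
  filter_upwards [eventually_gt_atTop 0] with x hx
  have hv : a + x • u - p = x • (x⁻¹ • (a - p) + u) := by
    rw [smul_add, smul_inv_smul₀ hx.ne']
    abel
  rw [dist_eq_norm, hv, norm_smul, Real.norm_of_nonneg hx.le, mul_div_cancel_left₀ _ hx.ne']

/-- The signed area spanned with a fixed segment is affine along a line. -/
theorem det2_sub_add_smul (s t a u : EuclideanSpace ℝ (Fin 2)) (x : ℝ) :
    det2 (s - (a + x • u)) (t - (a + x • u)) = det2 (s - a) (t - s) - x * det2 u (t - s) := by
  simp only [det2, PiLp.sub_apply, PiLp.add_apply, PiLp.smul_apply, smul_eq_mul]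
  ring

open Filter Topology in
theorem tendsto_abs_det2_sub_add_smul_div_atTop (s t a u : EuclideanSpace ℝ (Fin 2)) :
    Tendsto (fun x : ℝ => |det2 (s - (a + x • u)) (t - (a + x • u))| / x) atTop
      (𝓝 |det2 u (t - s)|) := by
  have h : Tendsto (fun x : ℝ => |x⁻¹ * det2 (s - a) (t - s) - det2 u (t - s)|) atTop
      (𝓝 |det2 u (t - s)|) := by
    simpa using
      ((tendsto_inv_atTop_zero.mul_const (det2 (s - a) (t - s))).sub_const (det2 u (t - s))).abs
  refine h.congr' ?_
  filter_upwards [eventually_gt_atTop 0] with x hx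
  rw [det2_sub_add_smul, div_eq_inv_mul, ← abs_of_pos (inv_pos.2 hx), ← abs_mul,
    abs_of_pos (inv_pos.2 hx), mul_sub, inv_mul_cancel_left₀ hx.ne']

theorem stmt12 (s t a u : EuclideanSpace ℝ (Fin 2)) (hst : s ≠ t) (hu : ‖u‖ = 1)
    (hpar : det2 u (t - s) ≠ 0) :
    Filter.Tendsto
      (fun x : ℝ =>
        |det2 (s - (a + x • u)) (t - (a + x • u))| /
          (dist (a + x • u) s + dist (a + x • u) t + dist s t))
      Filter.atTop (nhds (|det2 u (t - s)| / 2)) := by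
  have hden := ((tendsto_dist_add_smul_div_atTop a u s).add
    (tendsto_dist_add_smul_div_atTop a u t)).add
      (Filter.tendsto_id.const_div_atTop (dist s t))
  have h := (tendsto_abs_det2_sub_add_smul_div_atTop s t a u).div hden (by norm_num [hu])
  rw [hu, add_zero, one_add_one_eq_two] at h
  refine h.congr' ?_
  filter_upwards [Filter.eventually_gt_atTop 0] with x hx
  simp only [Pi.div_apply, id_eq, ← add_div]
  exact div_div_div_cancel_right₀ hx.ne' _ _
end

section
/- For every positive integer n ≥ 2 there exists a set S of n points in the Euclidean plane with the following property: letting 𝓜 be the family of circles {circle with diameter pq : p, q ∈ S, p ≠ q} (where the circle with diameter pq is the sphere centered at midpoint(p,q) with radius dist(p,q)/2), the set of points of the plane not in S that lie on at least two distinct circles of 𝓜 has cardinality at least (⌈n/2⌉·⌊n/2⌋ choose 2). -/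
/-- The family of circles whose diameters are the segments joining pairs of distinct
points of `S`: the circle with diameter `pq` is the sphere centered at `midpoint ℝ p q`
with radius `dist p q / 2`. -/
def diameterCircles (S : Finset (EuclideanSpace ℝ (Fin 2))) :
    Set (Set (EuclideanSpace ℝ (Fin 2))) :=
  {C | ∃ p ∈ S, ∃ q ∈ S, p ≠ q ∧ C = Metric.sphere (midpoint ℝ p q) (dist p q / 2)}

theorem diameterCircles_finite (S : Finset (EuclideanSpace ℝ (Fin 2))) :
    (diameterCircles S).Finite := by
  refine ((S ×ˢ S).finite_toSet.image
    fun e => Metric.sphere (midpoint ℝ e.1 e.2) (dist e.1 e.2 / 2)).subset ?_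
  rintro C ⟨p, hp, q, hq, -, rfl⟩
  exact ⟨(p, q), by simp [hp, hq], rfl⟩

/-- Two distinct circles in the plane have finitely many common points. -/
theorem Metric.sphere_inter_sphere_finite {c₁ c₂ : EuclideanSpace ℝ (Fin 2)} {r₁ r₂ : ℝ}
    (h : Metric.sphere c₁ r₁ ≠ Metric.sphere c₂ r₂) :
    (Metric.sphere c₁ r₁ ∩ Metric.sphere c₂ r₂).Finite := by
  by_cases hs : (Metric.sphere c₁ r₁ ∩ Metric.sphere c₂ r₂).Subsingleton
  · exact hs.finite
  obtain ⟨x, hx, y, hy, hxy⟩ := Set.not_subsingleton_iff.mp hs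
  refine (Set.toFinite {x, y}).subset fun z hz => ?_
  have hne : (⟨c₁, r₁⟩ : EuclideanGeometry.Sphere (EuclideanSpace ℝ (Fin 2))) ≠ ⟨c₂, r₂⟩ := by
    rintro ⟨⟩
    exact h rfl
  exact EuclideanGeometry.eq_of_mem_sphere_of_mem_sphere_of_finrank_eq_two
    finrank_euclideanSpace_fin hne hxy hx.1 hy.1 hz.1 hx.2 hy.2 hz.2

theorem finite_crossings (S : Finset (EuclideanSpace ℝ (Fin 2))) :
    {x : EuclideanSpace ℝ (Fin 2) | x ∉ S ∧
      ∃ C₁ ∈ diameterCircles S, ∃ C₂ ∈ diameterCircles S,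
        C₁ ≠ C₂ ∧ x ∈ C₁ ∧ x ∈ C₂}.Finite := by
  have hfin := ((diameterCircles_finite S).prod (diameterCircles_finite S)).subset
    (Set.sep_subset _ fun e => e.1 ≠ e.2)
  refine (hfin.biUnion (t := fun e => e.1 ∩ e.2) ?_).subset ?_
  · rintro ⟨_, _⟩ ⟨⟨⟨p, -, q, -, -, rfl⟩, ⟨p', -, q', -, -, rfl⟩⟩, hne⟩
    exact Metric.sphere_inter_sphere_finite hne
  · rintro x ⟨-, C₁, h₁, C₂, h₂, hne, hx₁, hx₂⟩
    exact Set.mem_biUnion (x := (C₁, C₂)) ⟨⟨h₁, h₂⟩, hne⟩ ⟨hx₁, hx₂⟩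

/-- Thales' theorem in coordinates. -/
theorem mem_sphere_midpoint_iff (p q x : EuclideanSpace ℝ (Fin 2)) :
    x ∈ Metric.sphere (midpoint ℝ p q) (dist p q / 2) ↔
      (x 0 - p 0) * (x 0 - q 0) + (x 1 - p 1) * (x 1 - q 1) = 0 := by
  rw [Metric.mem_sphere, ← sq_eq_sq₀ dist_nonneg (by positivity), div_pow,
    EuclideanSpace.dist_sq_eq, EuclideanSpace.dist_sq_eq]
  simp only [Fin.sum_univ_two, Real.dist_eq, sq_abs, midpoint_eq_smul_add, PiLp.smul_apply,
    PiLp.add_apply, smul_eq_mul, invOf_eq_inv]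
  constructor <;> intro h <;> linear_combination h

/-- A point outside `S` lying on two circles of the family, one of which contains a point `y`
that the other does not, is one of the counted crossings. -/
theorem mem_crossings {S : Finset (EuclideanSpace ℝ (Fin 2))}
    {p q p' q' x y : EuclideanSpace ℝ (Fin 2)} (hxS : x ∉ S)
    (hp : p ∈ S) (hq : q ∈ S) (hp' : p' ∈ S) (hq' : q' ∈ S) (hpq : p ≠ q) (hpq' : p' ≠ q')
    (hx : (x 0 - p 0) * (x 0 - q 0) + (x 1 - p 1) * (x 1 - q 1) = 0)
    (hx' : (x 0 - p' 0) * (x 0 - q' 0) + (x 1 - p' 1) * (x 1 - q' 1) = 0)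
    (hy : (y 0 - p 0) * (y 0 - q 0) + (y 1 - p 1) * (y 1 - q 1) = 0)
    (hy' : (y 0 - p' 0) * (y 0 - q' 0) + (y 1 - p' 1) * (y 1 - q' 1) ≠ 0) :
    x ∈ {x : EuclideanSpace ℝ (Fin 2) | x ∉ S ∧
      ∃ C₁ ∈ diameterCircles S, ∃ C₂ ∈ diameterCircles S,
        C₁ ≠ C₂ ∧ x ∈ C₁ ∧ x ∈ C₂} := by
  refine ⟨hxS, _, ⟨p, hp, q, hq, hpq, rfl⟩, _, ⟨p', hp', q', hq', hpq', rfl⟩, fun h => hy' ?_,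
    (mem_sphere_midpoint_iff p q x).2 hx, (mem_sphere_midpoint_iff p' q' x).2 hx'⟩
  rw [← mem_sphere_midpoint_iff, ← h, mem_sphere_midpoint_iff]
  exact hy

/-- Finitely many polynomials, none of which vanishes identically, have a common
non-vanishing point. -/
theorem MvPolynomial.exists_forall_eval_ne_zero {ι σ : Type*} [Fintype ι]
    (f : ι → MvPolynomial σ ℝ) :
    ∃ v : σ → ℝ, ∀ i, (∃ w, MvPolynomial.eval w (f i) ≠ 0) → MvPolynomial.eval v (f i) ≠ 0 := by
  classical
  have hprod : ∏ i with f i ≠ 0, f i ≠ 0 :=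
    Finset.prod_ne_zero_iff.2 fun i hi => (Finset.mem_filter.1 hi).2
  obtain ⟨v, hv⟩ : ∃ v, MvPolynomial.eval v (∏ i with f i ≠ 0, f i) ≠ 0 := by
    by_contra! h
    exact hprod (MvPolynomial.funext fun v => by simp [h v])
  rw [map_prod, Finset.prod_ne_zero_iff] at hv
  refine ⟨v, fun i ⟨w, hw⟩ => hv i (Finset.mem_filter.2 ⟨Finset.mem_univ i, fun h => hw ?_⟩)⟩
  simp [h]

section RadicalAxis

variable {α β R : Type*} [CommRing R]

/-- Let the points indexed by `α` and by `β` lie on the vertical lines `x = -c` and `x = c`, with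
heights `v`. The circles with diameters `(i, j)` and `(k, l)` then have a horizontal radical axis,
of height `radicalNum v i k j l / radicalDen v i k j l`. -/
def radicalNum (v : α ⊕ β → R) (i k : α) (j l : β) : R :=
  v (.inl i) * v (.inr j) - v (.inl k) * v (.inr l)

/-- The denominator of the height of the radical axis; see `radicalNum`. -/
def radicalDen (v : α ⊕ β → R) (i k : α) (j l : β) : R :=
  v (.inl i) + v (.inr j) - v (.inl k) - v (.inr l)

theorem radicalNum_swap (v : α ⊕ β → R) (i k : α) (j l : β) :
    radicalNum v k i l j = -radicalNum v i k j l := by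
  simp only [radicalNum]; ring

theorem radicalDen_swap (v : α ⊕ β → R) (i k : α) (j l : β) :
    radicalDen v k i l j = -radicalDen v i k j l := by
  simp only [radicalDen]; ring

end RadicalAxis

/-- If the edge `(i, j)` does not belong to the matching `{(i', j'), (k', l')}`, then the two
radical axes differ for some choice of the heights. -/
theorem exists_radical_cross_ne {α β : Type*} {i k i' k' : α} {j l j' l' : β}
    (hik : i ≠ k) (hjl : j ≠ l) (hik' : i' ≠ k') (hjl' : j' ≠ l')
    (h : ¬(i = i' ∧ j = j')) (h' : ¬(i = k' ∧ j = l')) :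
    ∃ w : α ⊕ β → ℝ, radicalNum w i k j l * radicalDen w i' k' j' l' -
      radicalNum w i' k' j' l' * radicalDen w i k j l ≠ 0 := by
  classical
  by_cases hj : j = j'
  · subst hj
    have hi : i' ≠ i := fun e => h ⟨e.symm, rfl⟩
    refine ⟨Sum.elim (fun x => if x = i then 1 else 0) (fun y => if y = j then 2 else 0), ?_⟩
    by_cases hk : k' = i <;>
      norm_num [radicalNum, radicalDen, hjl.symm, hjl'.symm, hi, hik.symm, hk]
  by_cases hl : j = l'
  · subst hl
    have hk : k' ≠ i := fun e => h' ⟨e.symm, rfl⟩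
    refine ⟨Sum.elim (fun x => if x = i then 1 else 0) (fun y => if y = j then 2 else 0), ?_⟩
    by_cases hi : i' = i <;>
      norm_num [radicalNum, radicalDen, hjl.symm, hjl', hi, hik.symm, hk]
  · refine ⟨Sum.elim (fun x => if x = i' then 2 else if x = i then 1 else 0)
      (fun y => if y = j then 2 else 0), ?_⟩
    by_cases hi : i = i'
    · subst hi
      norm_num [radicalNum, radicalDen, hjl.symm, Ne.symm hj, Ne.symm hl, hik'.symm]
    · by_cases hk : k' = i <;>
        norm_num [radicalNum, radicalDen, hjl.symm, Ne.symm hj, Ne.symm hl, hi, hik'.symm, hk]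

/-- There are pairwise distinct heights for which no radical axis of two disjoint edges is
degenerate, and only the two orderings of a matching give the same radical axis. -/
theorem exists_generic_heights (α β : Type*) [Fintype α] [Fintype β] :
    ∃ v : α ⊕ β → ℝ, Function.Injective v ∧
      (∀ (i k : α) (j l : β), i ≠ k → radicalDen v i k j l ≠ 0) ∧
      ∀ (i k i' k' : α) (j l j' l' : β), i ≠ k → j ≠ l → i' ≠ k' → j' ≠ l' →
        radicalNum v i k j l * radicalDen v i' k' j' l' =
          radicalNum v i' k' j' l' * radicalDen v i k j l →
        i = i' ∧ k = k' ∧ j = j' ∧ l = l' ∨ i = k' ∧ k = i' ∧ j = l' ∧ l = j' := by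
  classical
  obtain ⟨v, hv⟩ := MvPolynomial.exists_forall_eval_ne_zero
    (Sum.elim (fun e : (α ⊕ β) × (α ⊕ β) => MvPolynomial.X e.1 - MvPolynomial.X e.2)
      (Sum.elim (fun e : (α × α) × (β × β) => radicalDen MvPolynomial.X e.1.1 e.1.2 e.2.1 e.2.2)
        (fun e : ((α × α) × (β × β)) × ((α × α) × (β × β)) =>
          radicalNum MvPolynomial.X e.1.1.1 e.1.1.2 e.1.2.1 e.1.2.2 *
            radicalDen MvPolynomial.X e.2.1.1 e.2.1.2 e.2.2.1 e.2.2.2 -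
          radicalNum MvPolynomial.X e.2.1.1 e.2.1.2 e.2.2.1 e.2.2.2 *
            radicalDen MvPolynomial.X e.1.1.1 e.1.1.2 e.1.2.1 e.1.2.2)))
  have eval_num (w : α ⊕ β → ℝ) (i k : α) (j l : β) :
      MvPolynomial.eval w (radicalNum MvPolynomial.X i k j l) = radicalNum w i k j l := by
    simp [radicalNum]
  have eval_den (w : α ⊕ β → ℝ) (i k : α) (j l : β) :
      MvPolynomial.eval w (radicalDen MvPolynomial.X i k j l) = radicalDen w i k j l := by
    simp [radicalDen]
  have cross (i k i' k' : α) (j l j' l' : β) (hik : i ≠ k) (hjl : j ≠ l) (hik' : i' ≠ k')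
      (hjl' : j' ≠ l')
      (heq : radicalNum v i k j l * radicalDen v i' k' j' l' =
        radicalNum v i' k' j' l' * radicalDen v i k j l) :
      (i = i' ∧ j = j') ∨ (i = k' ∧ j = l') := by
    by_contra! hcon
    have := hv (.inr (.inr (((i, k), (j, l)), ((i', k'), (j', l')))))
    simp only [Sum.elim_inr, map_sub, map_mul, eval_num, eval_den] at this
    exact this (exists_radical_cross_ne hik hjl hik' hjl' (not_and.2 hcon.1) (not_and.2 hcon.2))
      (sub_eq_zero.2 heq)
  refine ⟨v, fun s t hst => ?_, fun i k j l hik => ?_, ?_⟩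
  · by_contra hne
    have := hv (.inl (s, t)) ⟨Pi.single s 1, by simp [Ne.symm hne]⟩
    simp [hst] at this
  · have := hv (.inr (.inl ((i, k), (j, l)))) ⟨Pi.single (.inl i) 1, by
      simp [radicalDen, hik.symm]⟩
    simpa only [Sum.elim_inr, Sum.elim_inl, eval_den] using this
  · intro i k i' k' j l j' l' hik hjl hik' hjl' heq
    have h₁ := cross i k i' k' j l j' l' hik hjl hik' hjl' heq
    have h₂ := cross k i i' k' l j j' l' hik.symm hjl.symm hik' hjl' (by
      rw [radicalNum_swap v i k, radicalDen_swap v i k]; linear_combination -heq)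
    grind

theorem choose_two_le_crossing_count {a b : ℕ} (hb : 2 ≤ b) (hba : b ≤ a) (hab : a ≤ b + 1) :
    (a * b).choose 2 ≤ (a * a - a) * (b * b - b) + (a + b) := by
  rw [Nat.choose_two_right]
  refine Nat.div_le_of_le_mul ?_
  obtain ⟨y, rfl⟩ := Nat.exists_eq_add_of_le hb
  obtain ⟨x, rfl⟩ := Nat.exists_eq_add_of_le (hb.trans hba)
  have hx : (2 + x) * (2 + x) - (2 + x) = (x + 2) * (x + 1) :=
    Nat.sub_eq_of_eq_add (by ring)
  have hy : (2 + y) * (2 + y) - (2 + y) = (y + 2) * (y + 1) :=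
    Nat.sub_eq_of_eq_add (by ring)
  have hxy : (2 + x) * (2 + y) - 1 = x * y + 2 * x + 2 * y + 3 :=
    Nat.sub_eq_of_eq_add (by ring)
  rw [hx, hy, hxy]
  obtain rfl | rfl : x = y ∨ x = y + 1 := by omega
  · nlinarith [Nat.zero_le (x ^ 3), Nat.zero_le (x ^ 4), Nat.zero_le (x ^ 2)]
  · nlinarith [Nat.zero_le (y ^ 3), Nat.zero_le (y ^ 4), Nat.zero_le (y ^ 2)]

/-- The points at heights `v` on two vertical lines at distance `|c|` from the origin. -/
noncomputable def twoLinePoint {α β : Type*} (c : ℝ) (v : α ⊕ β → ℝ) (s : α ⊕ β) :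
    EuclideanSpace ℝ (Fin 2) :=
  !₂[Sum.elim (fun _ => -c) (fun _ => c) s, v s]

theorem twoLinePoint_zero_sq {α β : Type*} (c : ℝ) (v : α ⊕ β → ℝ) (s : α ⊕ β) :
    twoLinePoint c v s 0 ^ 2 = c ^ 2 := by
  cases s <;> simp [twoLinePoint]

theorem twoLinePoint_injective {α β : Type*} (c : ℝ) {v : α ⊕ β → ℝ}
    (hv : Function.Injective v) : Function.Injective (twoLinePoint c v) := fun s t h =>
  hv (by simpa [twoLinePoint] using congrArg (· 1) h)

theorem mem_crossings_of_twoLinePoint {α β : Type*} {c : ℝ} {v : α ⊕ β → ℝ}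
    (hv : Function.Injective v) {S : Finset (EuclideanSpace ℝ (Fin 2))}
    (hS : ∀ s, twoLinePoint c v s ∈ S) {x : EuclideanSpace ℝ (Fin 2)} (hxS : x ∉ S)
    {i k : α} {j l : β} (hne : i ≠ k ∨ j ≠ l)
    (h : x 0 ^ 2 - c ^ 2 + (x 1 - v (.inl i)) * (x 1 - v (.inr j)) = 0)
    (h' : x 0 ^ 2 - c ^ 2 + (x 1 - v (.inl k)) * (x 1 - v (.inr l)) = 0) :
    x ∈ {x : EuclideanSpace ℝ (Fin 2) | x ∉ S ∧
      ∃ C₁ ∈ diameterCircles S, ∃ C₂ ∈ diameterCircles S,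
        C₁ ≠ C₂ ∧ x ∈ C₁ ∧ x ∈ C₂} := by
  have hlr (i : α) (j : β) : v (.inl i) - v (.inr j) ≠ 0 :=
    sub_ne_zero.2 (hv.ne Sum.inl_ne_inr)
  have hinj := twoLinePoint_injective c hv
  have hx : (x 0 - twoLinePoint c v (.inl i) 0) * (x 0 - twoLinePoint c v (.inr j) 0) +
      (x 1 - twoLinePoint c v (.inl i) 1) * (x 1 - twoLinePoint c v (.inr j) 1) = 0 := by
    simp only [twoLinePoint, PiLp.toLp_apply, Matrix.cons_val_zero, Matrix.cons_val_one,
      Sum.elim_inl, Sum.elim_inr]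
    linear_combination h
  have hx' : (x 0 - twoLinePoint c v (.inl k) 0) * (x 0 - twoLinePoint c v (.inr l) 0) +
      (x 1 - twoLinePoint c v (.inl k) 1) * (x 1 - twoLinePoint c v (.inr l) 1) = 0 := by
    simp only [twoLinePoint, PiLp.toLp_apply, Matrix.cons_val_zero, Matrix.cons_val_one,
      Sum.elim_inl, Sum.elim_inr]
    linear_combination h'
  rcases hne with hik | hjl
  · refine mem_crossings (y := twoLinePoint c v (.inl i)) hxS (hS _) (hS _) (hS _) (hS _)
      (hinj.ne Sum.inl_ne_inr) (hinj.ne Sum.inl_ne_inr) hx hx' (by simp) ?_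
    have : v (.inl i) - v (.inl k) ≠ 0 := sub_ne_zero.2 (hv.ne (by simpa using hik))
    simpa [twoLinePoint] using ⟨this, hlr i l⟩
  · refine mem_crossings (y := twoLinePoint c v (.inr j)) hxS (hS _) (hS _) (hS _) (hS _)
      (hinj.ne Sum.inl_ne_inr) (hinj.ne Sum.inl_ne_inr) hx hx' (by simp) ?_
    have h₁ : v (.inr j) - v (.inr l) ≠ 0 := sub_ne_zero.2 (hv.ne (by simpa using hjl))
    have h₂ : v (.inr j) - v (.inl k) ≠ 0 := sub_ne_zero.2 (hv.ne Sum.inr_ne_inl)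
    simpa [twoLinePoint] using ⟨h₂, h₁⟩

theorem exists_many_crossings {a b : ℕ} (ha : 2 ≤ a) (hb : 2 ≤ b) :
    ∃ S : Finset (EuclideanSpace ℝ (Fin 2)), S.card = a + b ∧
      (a * a - a) * (b * b - b) + (a + b) ≤
        Set.ncard {x : EuclideanSpace ℝ (Fin 2) | x ∉ S ∧
          ∃ C₁ ∈ diameterCircles S, ∃ C₂ ∈ diameterCircles S,
            C₁ ≠ C₂ ∧ x ∈ C₁ ∧ x ∈ C₂} := by
  have : Nontrivial (Fin a) := Fin.nontrivial_iff_two_le.2 ha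
  have : Nontrivial (Fin b) := Fin.nontrivial_iff_two_le.2 hb
  obtain ⟨v, hv, hden, hcross⟩ := exists_generic_heights (Fin a) (Fin b)
  let y (e : (Fin a × Fin a) × (Fin b × Fin b)) : ℝ :=
    radicalNum v e.1.1 e.1.2 e.2.1 e.2.2 / radicalDen v e.1.1 e.1.2 e.2.1 e.2.2
  let P (e : (Fin a × Fin a) × (Fin b × Fin b)) : ℝ :=
    (y e - v (.inl e.1.1)) * (y e - v (.inr e.2.1))
  obtain ⟨c, hc, hP⟩ : ∃ c : ℝ, 0 < c ∧ ∀ e, P e < c ^ 2 := by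
    obtain ⟨B, hB⟩ := (Set.finite_range P).bddAbove
    refine ⟨|B| + 1, by positivity, fun e => ?_⟩
    nlinarith [hB (Set.mem_range_self e), le_abs_self B, abs_nonneg B]
  -- The two circles of `e` meet at height `y e`.
  have hP' (e) (he : e.1.1 ≠ e.1.2) :
      P e = (y e - v (.inl e.1.2)) * (y e - v (.inr e.2.2)) := by
    have : y e * radicalDen v e.1.1 e.1.2 e.2.1 e.2.2 = radicalNum v e.1.1 e.1.2 e.2.1 e.2.2 :=
      div_mul_cancel₀ _ (hden _ _ _ _ he)
    simp only [radicalDen, radicalNum] at this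
    simp only [P]
    linear_combination -this
  have hP0 (e) (he : e.1.1 ≠ e.1.2) (he' : e.2.1 ≠ e.2.2) : P e ≠ 0 := by
    intro h0
    have h1 := hP' e he
    rw [h0, eq_comm, mul_eq_zero, sub_eq_zero, sub_eq_zero] at h1
    simp only [P, mul_eq_zero, sub_eq_zero] at h0
    rcases h0 with h0 | h0 <;> rcases h1 with h1 | h1 <;> have := hv (h0.symm.trans h1) <;>
      simp_all
  let X (e : (Fin a × Fin a) × (Fin b × Fin b)) : ℝ :=
    if e.1.1 < e.1.2 then √(c ^ 2 - P e) else -√(c ^ 2 - P e)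
  have hX (e) : X e ^ 2 = c ^ 2 - P e := by
    have := Real.sq_sqrt (sub_pos.2 (hP e)).le
    simp only [X]
    split_ifs <;> simpa
  let S : Finset (EuclideanSpace ℝ (Fin 2)) :=
    Finset.univ.map ⟨twoLinePoint c v, twoLinePoint_injective c hv⟩
  have hS (s) : twoLinePoint c v s ∈ S := by simp [S]
  let T : Finset (((Fin a × Fin a) × (Fin b × Fin b)) ⊕ (Fin a ⊕ Fin b)) :=
    (Finset.univ.offDiag ×ˢ Finset.univ.offDiag).disjSum Finset.univ
  let Φ : ((Fin a × Fin a) × (Fin b × Fin b)) ⊕ (Fin a ⊕ Fin b) → EuclideanSpace ℝ (Fin 2) :=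
    Sum.elim (fun e => !₂[X e, y e]) (twoLinePoint (-c) v)
  have hoff (e : (Fin a × Fin a) × (Fin b × Fin b)) (he : .inl e ∈ T) :
      e.1.1 ≠ e.1.2 ∧ e.2.1 ≠ e.2.2 := by
    simpa [T] using he
  have hne (e) (he : .inl e ∈ T) (d : ℝ) (hd : d ^ 2 = c ^ 2) (s) :
      Φ (.inl e) ≠ twoLinePoint d v s := by
    intro h
    have h2 : X e ^ 2 = d ^ 2 := by
      rw [← twoLinePoint_zero_sq d v s, ← h]
      simp [Φ]
    exact hP0 e (hoff e he).1 (hoff e he).2 (by linarith [hX e])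
  refine ⟨S, by simp [S], ?_⟩
  calc (a * a - a) * (b * b - b) + (a + b) = (T : Set _).ncard := by
        rw [Set.ncard_coe_finset]
        simp [T, Finset.offDiag_card]
    _ ≤ _ := Set.ncard_le_ncard_of_injOn Φ ?_ ?_ (finite_crossings S)
  · rintro (e | s) ht
    · obtain ⟨he, he'⟩ := hoff e ht
      refine mem_crossings_of_twoLinePoint hv hS ?_ (.inl he) (j := e.2.1) (l := e.2.2) ?_ ?_
      · simp only [S, Finset.mem_map, not_exists, not_and]
        exact fun s _ h => hne e ht c rfl s h.symm
      · change X e ^ 2 - c ^ 2 + P e = 0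
        linarith [hX e]
      · change X e ^ 2 - c ^ 2 + (y e - v (.inl e.1.2)) * (y e - v (.inr e.2.2)) = 0
        linarith [hX e, hP' e he]
    · have hs : Φ (.inr s) ∉ S := by
        simp only [S, Finset.mem_map, not_exists, not_and]
        intro t _ h
        obtain rfl : t = s := hv (by simpa [Φ, twoLinePoint] using congrArg (· 1) h)
        have h0 : twoLinePoint c v t 0 = twoLinePoint (-c) v t 0 := congrArg (· 0) h
        cases t <;> simp [twoLinePoint] at h0 <;> linarith
      rcases s with i | j
      · obtain ⟨j, l, hjl⟩ := exists_pair_ne (Fin b)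
        exact mem_crossings_of_twoLinePoint hv hS hs (i := i) (k := i) (.inr hjl)
          (by simp [Φ, twoLinePoint]) (by simp [Φ, twoLinePoint])
      · obtain ⟨i, k, hik⟩ := exists_pair_ne (Fin a)
        exact mem_crossings_of_twoLinePoint hv hS hs (j := j) (l := j) (.inl hik)
          (by simp [Φ, twoLinePoint]) (by simp [Φ, twoLinePoint])
  · rintro (e | s) ht (e' | s') ht' h
    · obtain ⟨he₁, he₂⟩ := hoff e ht
      obtain ⟨he₁', he₂'⟩ := hoff e' ht'
      have h0 : X e = X e' := by simpa [Φ] using congrArg (· 0) h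
      have h1 : y e = y e' := by simpa [Φ] using congrArg (· 1) h
      rcases hcross _ _ _ _ _ _ _ _ he₁ he₂ he₁' he₂'
        ((div_eq_div_iff (hden _ _ _ _ he₁) (hden _ _ _ _ he₁')).1 h1) with hee | ⟨h₁, h₂, -, -⟩
      · exact congrArg Sum.inl (by ext <;> simp [hee])
      · exfalso
        have hpos (e) : 0 < √(c ^ 2 - P e) := Real.sqrt_pos.2 (sub_pos.2 (hP e))
        have := hpos e
        have := hpos e'
        simp only [X, h₁, h₂] at h0
        rcases lt_or_gt_of_ne he₁' with hlt | hlt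
        · rw [if_neg hlt.not_gt, if_pos hlt] at h0
          linarith
        · rw [if_pos hlt, if_neg hlt.not_gt] at h0
          linarith
    · exact (hne e ht (-c) (by ring) s' h).elim
    · exact (hne e' ht' (-c) (by ring) s h.symm).elim
    · exact congrArg Sum.inr (twoLinePoint_injective (-c) hv h)

theorem exists_three_points_crossing :
    ∃ S : Finset (EuclideanSpace ℝ (Fin 2)), S.card = 3 ∧
      1 ≤ Set.ncard {x : EuclideanSpace ℝ (Fin 2) | x ∉ S ∧
          ∃ C₁ ∈ diameterCircles S, ∃ C₂ ∈ diameterCircles S,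
            C₁ ≠ C₂ ∧ x ∈ C₁ ∧ x ∈ C₂} := by
  classical
  have h₁ : (!₂[0, 2] : EuclideanSpace ℝ (Fin 2)) ≠ !₂[1, 0] := fun h => by
    simpa using congrArg (· 0) h
  have h₂ : (!₂[0, 2] : EuclideanSpace ℝ (Fin 2)) ≠ !₂[-1, 0] := fun h => by
    simpa using congrArg (· 0) h
  have h₃ : (!₂[1, 0] : EuclideanSpace ℝ (Fin 2)) ≠ !₂[-1, 0] := fun h => by
    have := congrArg (· 0) h
    norm_num at this
  refine ⟨{!₂[0, 2], !₂[1, 0], !₂[-1, 0]}, Finset.card_eq_three.2 ⟨_, _, _, h₁, h₂, h₃, rfl⟩, ?_⟩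
  rw [Nat.one_le_iff_ne_zero, ← Nat.pos_iff_ne_zero, Set.ncard_pos (finite_crossings _)]
  refine ⟨!₂[0, 0], mem_crossings (p := !₂[0, 2]) (q := !₂[1, 0]) (p' := !₂[0, 2])
    (q' := !₂[-1, 0]) (y := !₂[1, 0]) ?_ (by simp) (by simp) (by simp) (by simp) h₁ h₂
    (by simp) (by simp) (by simp) (by norm_num)⟩
  simp only [Finset.mem_insert, Finset.mem_singleton, not_or]
  refine ⟨fun h => ?_, fun h => ?_, fun h => ?_⟩
  · simpa using congrArg (· 1) h
  · simpa using congrArg (· 0) h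
  · simpa using congrArg (· 0) h

theorem stmt13 (n : ℕ) (hn : 2 ≤ n) :
    ∃ S : Finset (EuclideanSpace ℝ (Fin 2)), S.card = n ∧
      (((n + 1) / 2 * (n / 2)).choose 2 : ℕ) ≤
        Set.ncard {x : EuclideanSpace ℝ (Fin 2) | x ∉ S ∧
          ∃ C₁ ∈ diameterCircles S, ∃ C₂ ∈ diameterCircles S,
            C₁ ≠ C₂ ∧ x ∈ C₁ ∧ x ∈ C₂} := by
  obtain rfl | rfl | hn : n = 2 ∨ n = 3 ∨ 4 ≤ n := by omega
  · obtain ⟨S, hS⟩ := Infinite.exists_subset_card_eq (EuclideanSpace ℝ (Fin 2)) 2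
    exact ⟨S, hS, Nat.zero_le _⟩
  · exact exists_three_points_crossing
  · obtain ⟨S, hS, hcard⟩ := exists_many_crossings (a := (n + 1) / 2) (b := n / 2)
      (by omega) (by omega)
    exact ⟨S, by omega, (choose_two_le_crossing_count (by omega) (by omega) (by omega)).trans hcard⟩
end
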